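/- Let f, u : Ω → ℝ be C² solutions of Δw = ν·w on an open set Ω ⊆ ℂ with f nonvanishing, and let Γ be a closed piecewise-C¹ curve contained in a simply connected open subset of Ω. Then Re ∮_Γ ∂_z(u/f) dz + i·Im ∮_Γ f²·∂_z(u/f) dz = 0, where ∂_z = (1/2)(∂_x − i∂_y) and ∮_Γ g dz = ∮_Γ g (dx + i dy). -/

import Mathlib

open Complex Set

/-- Partial derivative in the x-direction. -/
noncomputable def pdx (F : ℂ → ℂ) (z : ℂ) : ℂ := fderiv ℝ F z 1
/-- Partial derivative in the y-direction. -/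
noncomputable def pdy (F : ℂ → ℂ) (z : ℂ) : ℂ := fderiv ℝ F z Complex.I
/-- Wirtinger derivative ∂_z = (1/2)(∂_x − i∂_y). -/
noncomputable def dz (F : ℂ → ℂ) (z : ℂ) : ℂ := (pdx F z - Complex.I * pdy F z) / 2
/-- Wirtinger derivative ∂_z̄ = (1/2)(∂_x + i∂_y). -/
noncomputable def dzbar (F : ℂ → ℂ) (z : ℂ) : ℂ := (pdx F z + Complex.I * pdy F z) / 2
/-- Laplacian Δ = ∂_xx + ∂_yy. -/
noncomputable def lap (F : ℂ → ℂ) (z : ℂ) : ℂ := pdx (pdx F) z + pdy (pdy F) z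

/-- A closed piecewise-C¹ curve parametrized on [0,1]. -/
structure IsClosedPiecewiseC1Curve (γ : ℝ → ℂ) : Prop where
  cont : ContinuousOn γ (Set.Icc 0 1)
  closed : γ 0 = γ 1
  pw : ∃ s : Finset ℝ, ∀ t ∈ Set.Icc (0:ℝ) 1, t ∉ s →
    DifferentiableAt ℝ γ t ∧ ContinuousAt (deriv γ) t

/-- Contour integral ∮_Γ g dz along a curve parametrized on [0,1]. -/
noncomputable def contourIntegral (g : ℂ → ℂ) (γ : ℝ → ℂ) : ℂ :=
  ∫ t in (0:ℝ)..1, g (γ t) * deriv γ t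

open scoped Topology

/-- If every point of a simply connected open set `U` has a ball on which the 1-form `ω` has a
primitive, then `ω` has a primitive on `U`. The primitives form a covering space of `U` with
fibre `K`, a discrete copy of the target space, and a global section of it is a primitive. -/
theorem exists_primitive_of_locally_exact_aux {E F K : Type*}
    [NormedAddCommGroup E] [NormedSpace ℝ E] [NormedAddCommGroup F] [NormedSpace ℝ F]
    [TopologicalSpace K] [DiscreteTopology K] (e : K ≃ F)
    {U : Set E} (hU : IsOpen U) (hUsc : SimplyConnectedSpace U) {ω : E → E →L[ℝ] F}
    (hω : ∀ a ∈ U, ∃ r > 0, ∃ φ : E → F, ∀ x ∈ Metric.ball a r, HasFDerivAt φ (ω x) x) :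
    ∃ W : E → F, ∀ a ∈ U, HasFDerivAt W (ω a) a := by
  classical
  choose! r hr φ hφ using hω
  have hself (a : U) : (a : E) ∈ Metric.ball (a : E) (r a) := Metric.mem_ball_self (hr a a.2)
  let Z : FiberBundleCore U U K :=
    { baseSet := fun i => Subtype.val ⁻¹' Metric.ball (i : E) (r i)
      isOpen_baseSet := fun i => Metric.isOpen_ball.preimage continuous_subtype_val
      indexAt := id
      mem_baseSet_at := fun x => hself x
      coordChange := fun i j x v => e.symm (e v + φ i x - φ j x)
      coordChange_self := fun i x _ v => by simp
      continuousOn_coordChange := fun i j => by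
        have hd : ∀ x ∈ Metric.ball (i : E) (r i) ∩ Metric.ball (j : E) (r j),
            HasFDerivAt (fun y => φ i y - φ j y) (0 : E →L[ℝ] F) x := fun x hx => by
          simpa using (hφ i i.2 x hx.1).fun_sub (hφ j j.2 x hx.2)
        obtain ⟨c, hc⟩ := (Metric.isOpen_ball.inter Metric.isOpen_ball
            : IsOpen (Metric.ball (i : E) (r i) ∩ Metric.ball (j : E) (r j))
          ).exists_is_const_of_fderiv_eq_zero (𝕜 := ℝ)
          ((convex_ball _ _).inter (convex_ball _ _)).isPreconnected
          (fun x hx => (hd x hx).differentiableAt.differentiableWithinAt)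
          (fun x hx => (hd x hx).fderiv)
        have hcont : Continuous fun p : U × K => e.symm (e p.2 + c) :=
          (continuous_of_discreteTopology (f := fun k : K => e.symm (e k + c))).comp
            continuous_snd
        refine hcont.continuousOn.congr fun p hp => ?_
        simp only [← hc p.1 hp.1, add_sub_assoc]
      coordChange_comp := fun i j k x _ v => by simp }
  have hcov : IsCoveringMap Z.proj := FiberBundle.isCoveringMap (F := K) (E := Z.Fiber)
  have := hU.locallyPathConnectedSpace
  obtain ⟨a₀⟩ : Nonempty U := inferInstance
  obtain ⟨S, ⟨-, hS⟩, -⟩ := hcov.existsUnique_continuousMap_lifts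
    (ContinuousMap.id U) a₀ ⟨a₀, e.symm 0⟩ rfl
  have hS' (x : U) : (S x).1 = x := congr_fun hS x
  let W : E → F := fun x => if hx : x ∈ U then e (S ⟨x, hx⟩).2 + φ x x else 0
  refine ⟨W, fun a ha => ?_⟩
  lift a to U using ha
  have hcoord : ContinuousAt (fun x : U => (Z.localTriv a (S x)).2) a :=
    (((Z.localTriv a).continuousOn_toFun.continuousAt
      ((Z.localTriv a).open_source.mem_nhds (by
        rw [Z.mem_localTriv_source, hS']; exact hself a))).comp S.continuous.continuousAt).snd
  have hev : ∀ᶠ x : U in 𝓝 a, (Z.localTriv a (S x)).2 = (Z.localTriv a (S a)).2 :=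
    hcoord.eventually_mem (isOpen_discrete {_} |>.mem_nhds rfl)
  have hev' : ∀ᶠ x in 𝓝 (a : E), W x = φ a x + e (Z.localTriv a (S a)).2 := by
    rw [← hU.isOpenEmbedding_subtypeVal.map_nhds_eq a, Filter.eventually_map]
    refine hev.mono fun x hx => ?_
    have hval : e (Z.localTriv a (S x)).2 = e (S x).2 + φ (S x).1 (S x).1 - φ a (S x).1 :=
      e.apply_symm_apply _
    rw [← hx, hval, hS']
    simp [W]
  exact ((hφ a a.2 a (hself a)).add_const _).congr_of_eventuallyEq hev'

theorem exists_primitive_of_locally_exact {E F : Type*}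
    [NormedAddCommGroup E] [NormedSpace ℝ E] [NormedAddCommGroup F] [NormedSpace ℝ F]
    {U : Set E} (hU : IsOpen U) (hUsc : SimplyConnectedSpace U) {ω : E → E →L[ℝ] F}
    (hω : ∀ a ∈ U, ∃ r > 0, ∃ φ : E → F, ∀ x ∈ Metric.ball a r, HasFDerivAt φ (ω x) x) :
    ∃ W : E → F, ∀ a ∈ U, HasFDerivAt W (ω a) a :=
  let _ : TopologicalSpace (ULift.{0} F) := ⊥
  have : DiscreteTopology (ULift.{0} F) := ⟨rfl⟩
  exists_primitive_of_locally_exact_aux (K := ULift.{0} F) Equiv.ulift hU hUsc hω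

/-- **Poincaré lemma** on simply connected open sets: a differentiable closed 1-form is exact. -/
theorem exists_primitive_of_closed {E F : Type*}
    [NormedAddCommGroup E] [NormedSpace ℝ E] [NormedAddCommGroup F] [NormedSpace ℝ F]
    [CompleteSpace F]
    {U : Set E} (hU : IsOpen U) (hUsc : SimplyConnectedSpace U) {ω : E → E →L[ℝ] F}
    (hω : DifferentiableOn ℝ ω U)
    (hsymm : ∀ a ∈ U, ∀ x y, fderiv ℝ ω a x y = fderiv ℝ ω a y x) :
    ∃ W : E → F, ∀ a ∈ U, HasFDerivAt W (ω a) a := by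
  refine exists_primitive_of_locally_exact hU hUsc fun a ha => ?_
  obtain ⟨r, hr, hrU⟩ := Metric.isOpen_iff.1 hU a ha
  exact ⟨r, hr, (convex_ball a r).exists_forall_hasFDerivAt_of_fderiv_symmetric
    Metric.isOpen_ball (hω.mono hrU) fun x hx => hsymm x (hrU hx)⟩

/-- The real-linear functional `L` annihilates the contour integral of `g` along a closed curve if
`L (g z dz)` is an exact 1-form. -/
theorem map_contourIntegral_eq_zero_of_exact {γ : ℝ → ℂ} (hγ : IsClosedPiecewiseC1Curve γ)
    {U : Set ℂ} (hγU : ∀ t ∈ Set.Icc (0:ℝ) 1, γ t ∈ U) {ω : ℂ → ℂ →L[ℝ] ℝ} {W : ℂ → ℝ}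
    (hW : ∀ z ∈ U, HasFDerivAt W (ω z) z) {g : ℂ → ℂ} (L : ℂ →L[ℝ] ℝ)
    (hL : ∀ z ∈ U, ∀ v, L (g z * v) = ω z v) :
    L (contourIntegral g γ) = 0 := by
  unfold contourIntegral
  by_cases hint : IntervalIntegrable (fun t => g (γ t) * deriv γ t) MeasureTheory.volume 0 1
  · rw [← L.intervalIntegral_comp_comm hint]
    obtain ⟨s, hs⟩ := hγ.pw
    rw [MeasureTheory.integral_eq_of_hasDerivAt_off_countable_of_le (fun t => W (γ t)) _
      zero_le_one s.countable_toSet]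
    · simp [hγ.closed]
    · exact ContinuousOn.comp (t := U)
        (fun z hz => (hW z hz).continuousAt.continuousWithinAt) hγ.cont hγU
    · intro t ht
      have ht' := Ioo_subset_Icc_self ht.1
      rw [hL _ (hγU t ht')]
      exact (hW _ (hγU t ht')).comp_hasDerivAt t (hs t ht' ht.2).1.hasDerivAt
    · exact ⟨L.integrable_comp hint.1, L.integrable_comp hint.2⟩
  · rw [intervalIntegral.integral_undef hint, map_zero]

theorem fderiv_ofReal_comp {g : ℂ → ℝ} {z : ℂ} (hg : DifferentiableAt ℝ g z) (v : ℂ) :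
    fderiv ℝ (fun w => (g w : ℂ)) z v = (fderiv ℝ g z v : ℝ) := by
  have h := (Complex.ofRealCLM.hasFDerivAt.comp z hg.hasFDerivAt).fderiv
  exact congr($h v)

theorem dz_ofReal {g : ℂ → ℝ} {z : ℂ} (hg : DifferentiableAt ℝ g z) :
    dz (fun w => (g w : ℂ)) z
      = ((fderiv ℝ g z 1 : ℝ) - I * (fderiv ℝ g z I : ℝ)) / 2 := by
  simp only [dz, pdx, pdy, fderiv_ofReal_comp hg]

theorem lap_ofReal {g : ℂ → ℝ} {z : ℂ} (hg : ContDiffAt ℝ 2 g z) :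
    lap (fun w => (g w : ℂ)) z
      = (fderiv ℝ (fderiv ℝ g) z 1 1 + fderiv ℝ (fderiv ℝ g) z I I : ℝ) := by
  have hd : DifferentiableAt ℝ (fderiv ℝ g) z :=
    (hg.fderiv_right (m := 1) (by norm_num)).differentiableAt (by norm_num)
  have hev : ∀ᶠ w in 𝓝 z, DifferentiableAt ℝ g w :=
    (hg.eventually (by simp)).mono fun w hw => hw.differentiableAt (by norm_num)
  have key (v : ℂ) : fderiv ℝ (fun w => fderiv ℝ (fun w => (g w : ℂ)) w v) z v
      = (fderiv ℝ (fderiv ℝ g) z v v : ℝ) := by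
    have hev' : (fun w => fderiv ℝ (fun w => (g w : ℂ)) w v)
        =ᶠ[𝓝 z] fun w => ((fderiv ℝ g w v : ℝ) : ℂ) :=
      hev.mono fun w hw => fderiv_ofReal_comp hw v
    rw [hev'.fderiv_eq, fderiv_ofReal_comp (hd.clm_apply (differentiableAt_const v)),
      fderiv_clm_apply hd (differentiableAt_const v)]
    simp
  simp only [lap, Complex.ofReal_add, ← key]
  rfl

theorem hasFDerivAt_div_real {g h : ℂ → ℝ} {z : ℂ} (hg : DifferentiableAt ℝ g z)
    (hh : DifferentiableAt ℝ h z) (h0 : h z ≠ 0) :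
    HasFDerivAt (fun w => g w / h w)
      ((h z ^ 2)⁻¹ • (h z • fderiv ℝ g z - g z • fderiv ℝ h z)) z := by
  have hmul := hg.hasFDerivAt.mul ((hasDerivAt_inv h0).comp_hasFDerivAt z hh.hasFDerivAt)
  refine (hmul.congr_fderiv ?_).congr_of_eventuallyEq (.of_forall fun w => ?_)
  · ext v
    simp
    field_simp
    ring
  · simp [div_eq_mul_inv]

theorem contDiffOn_of_ofReal {g : ℂ → ℝ} {s : Set ℂ} {n : WithTop ℕ∞}
    (hg : ContDiffOn ℝ n (fun z => (g z : ℂ)) s) : ContDiffOn ℝ n g s :=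
  Complex.reCLM.contDiff.comp_contDiffOn hg

/-- Bilinear forms on `ℂ` are symmetric as soon as they are so on the basis `1, I`. -/
theorem bilin_symm_of_one_I (B : ℂ →L[ℝ] ℂ →L[ℝ] ℝ) (h : B 1 I = B I 1) (x y : ℂ) :
    B x y = B y x := by
  have hx (v : ℂ) : v = v.re • (1 : ℂ) + v.im • I := by simp
  rw [hx x, hx y]
  simp only [map_add, map_smul, add_apply, smul_apply,
    smul_eq_mul, h]
  ring

/-- Multiplication by `-I` on `ℂ`, as a real-linear map. -/
noncomputable def mulNegI : ℂ →L[ℝ] ℂ := ContinuousLinearMap.mul ℝ ℂ (-I)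

/-- The 1-form `Im (f² ∂_z(u/f) dz) = ½ (f ⋆du - u ⋆df)`. -/
noncomputable def conjForm (f u : ℂ → ℝ) (z : ℂ) : ℂ →L[ℝ] ℝ :=
  (1 / 2 : ℝ) • (f z • (fderiv ℝ u z ∘L mulNegI) - u z • (fderiv ℝ f z ∘L mulNegI))

theorem exists_primitive_conjForm {f u ν : ℂ → ℝ} {U : Set ℂ} (hU : IsOpen U)
    (hUsc : SimplyConnectedSpace U) (hf : ContDiffOn ℝ 2 f U) (hu : ContDiffOn ℝ 2 u U)
    (hSf : ∀ z ∈ U, lap (fun w => (f w : ℂ)) z = (ν z : ℂ) * (f z : ℂ))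
    (hSu : ∀ z ∈ U, lap (fun w => (u w : ℂ)) z = (ν z : ℂ) * (u z : ℂ)) :
    ∃ W : ℂ → ℝ, ∀ z ∈ U, HasFDerivAt W (conjForm f u z) z := by
  have hdiff {g : ℂ → ℝ} (hg : ContDiffOn ℝ 2 g U) {z : ℂ} (hz : z ∈ U) :
      ContDiffAt ℝ 2 g z ∧ HasFDerivAt g (fderiv ℝ g z) z ∧
        HasFDerivAt (fun w => fderiv ℝ g w ∘L mulNegI)
          (((ContinuousLinearMap.compL ℝ ℂ ℂ ℝ).flip mulNegI) ∘L fderiv ℝ (fderiv ℝ g) z) z := by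
    have h := hg.contDiffAt (hU.mem_nhds hz)
    exact ⟨h, (h.differentiableAt (by norm_num)).hasFDerivAt,
      ((ContinuousLinearMap.compL ℝ ℂ ℂ ℝ).flip mulNegI).hasFDerivAt.comp z
      ((h.fderiv_right (m := 1) (by norm_num)).differentiableAt (by norm_num)).hasFDerivAt⟩
  have hform {z : ℂ} (hz : z ∈ U) := (((hdiff hf hz).2.1.smul (hdiff hu hz).2.2).sub
    ((hdiff hu hz).2.1.smul (hdiff hf hz).2.2)).const_smul (1 / 2 : ℝ)
  refine exists_primitive_of_closed hU hUsc (ω := conjForm f u)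
    (fun z hz => (hform hz).differentiableAt.differentiableWithinAt)
    fun z hz => bilin_symm_of_one_I _ ?_
  have h1 := hSf z hz
  have h2 := hSu z hz
  rw [lap_ofReal (hdiff hf hz).1] at h1
  rw [lap_ofReal (hdiff hu hz).1] at h2
  norm_cast at h1 h2
  rw [show fderiv ℝ (conjForm f u) z = _ from (hform hz).fderiv]
  simp [mulNegI]
  linear_combination f z * h2 - u z * h1

theorem cauchy_integral_schrodinger
    (Ω : Set ℂ) (hΩ : IsOpen Ω) (f u : ℂ → ℝ) (ν : ℂ → ℝ)
    (hf : ContDiffOn ℝ 2 (fun z => (f z : ℂ)) Ω)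
    (hu : ContDiffOn ℝ 2 (fun z => (u z : ℂ)) Ω)
    (hf0 : ∀ z ∈ Ω, f z ≠ 0)
    (hSchrf : ∀ z ∈ Ω, lap (fun w => (f w : ℂ)) z = (ν z : ℂ) * (f z : ℂ))
    (hSchru : ∀ z ∈ Ω, lap (fun w => (u w : ℂ)) z = (ν z : ℂ) * (u z : ℂ))
    (γ : ℝ → ℂ) (hγ : IsClosedPiecewiseC1Curve γ)
    (U : Set ℂ) (hU : IsOpen U) (hUΩ : U ⊆ Ω) (hUsc : SimplyConnectedSpace ↥U)
    (hγU : ∀ t ∈ Set.Icc (0:ℝ) 1, γ t ∈ U) :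
    ((contourIntegral (fun z => dz (fun w => (u w : ℂ) / (f w : ℂ)) z) γ).re : ℂ)
      + Complex.I
        * ((contourIntegral
              (fun z => ((f z : ℂ)) ^ 2 * dz (fun w => (u w : ℂ) / (f w : ℂ)) z)
              γ).im : ℂ)
      = 0 := by
  have hf' : ContDiffOn ℝ 2 f Ω := contDiffOn_of_ofReal hf
  have hu' : ContDiffOn ℝ 2 u Ω := contDiffOn_of_ofReal hu
  have hdf {z : ℂ} (hz : z ∈ U) : DifferentiableAt ℝ f z :=
    (hf'.contDiffAt (hΩ.mem_nhds (hUΩ hz))).differentiableAt (by norm_num)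
  have hdu {z : ℂ} (hz : z ∈ U) : DifferentiableAt ℝ u z :=
    (hu'.contDiffAt (hΩ.mem_nhds (hUΩ hz))).differentiableAt (by norm_num)
  have hdq {z : ℂ} (hz : z ∈ U) : DifferentiableAt ℝ (fun w => u w / f w) z :=
    (hasFDerivAt_div_real (hdu hz) (hdf hz) (hf0 z (hUΩ hz))).differentiableAt
  have hquot {z : ℂ} (hz : z ∈ U) (v : ℂ) : f z ^ 2 * fderiv ℝ (fun w => u w / f w) z v
      = f z * fderiv ℝ u z v - u z * fderiv ℝ f z v := by
    have h0 := hf0 z (hUΩ hz)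
    rw [(hasFDerivAt_div_real (hdu hz) (hdf hz) h0).fderiv]
    simp
    field_simp
  simp only [← Complex.ofReal_div]
  have hre := map_contourIntegral_eq_zero_of_exact hγ hγU
    (g := fun z => dz (fun w => ((u w / f w : ℝ) : ℂ)) z)
    (fun z hz => (hdq hz).hasFDerivAt.const_smul (1 / 2 : ℝ)) Complex.reCLM fun z hz v => by
      rw [dz_ofReal (hdq hz)]
      conv_rhs => rw [show v = v.re • (1 : ℂ) + v.im • I by simp]
      simp only [map_add, map_smul, smul_apply, smul_eq_mul]
      simp
      ring
  obtain ⟨W, hW⟩ := exists_primitive_conjForm hU hUsc (hf'.mono hUΩ) (hu'.mono hUΩ)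
    (fun z hz => hSchrf z (hUΩ hz)) (fun z hz => hSchru z (hUΩ hz))
  have him := map_contourIntegral_eq_zero_of_exact hγ hγU
    (g := fun z => (f z : ℂ) ^ 2 * dz (fun w => ((u w / f w : ℝ) : ℂ)) z)
    hW Complex.imCLM fun z hz v => by
      have hv : mulNegI v = v.im • (1 : ℂ) - v.re • I := by
        apply Complex.ext <;> simp [mulNegI]
      have h1 := hquot hz 1
      have h2 := hquot hz I
      rw [dz_ofReal (hdq hz)]
      simp only [conjForm, smul_apply, sub_apply,
        ContinuousLinearMap.comp_apply, hv, map_sub, map_smul, smul_eq_mul]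
      rw [← Complex.ofReal_pow, mul_assoc]
      simp only [Complex.imCLM_apply, Complex.im_ofReal_mul]
      simp
      linear_combination v.im / 2 * h1 - v.re / 2 * h2
  rw [Complex.reCLM_apply] at hre
  rw [Complex.imCLM_apply] at him
  simp only [hre, him, Complex.ofReal_zero, mul_zero, add_zero]
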